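/- Let ξ ∈ ℝ. There exists a constant κ > 0 depending only on ξ such that for any non-zero v, w, x, y, z ∈ ℝ⁴ with L(v)/‖v‖ ≥ L(w)/‖w‖ ≥ L(x)/‖x‖ ≥ L(y)/‖y‖ ≥ L(z)/‖z‖ and for any sign ε ∈ {−,+}, the number d_ε = det(v, w, x, Ψ_ε(x,y,z)) satisfies |d_ε| ≤ κ(‖y‖²L(x)L(z) + ‖x‖‖z‖L(y)²)·L(v)L(w)L(x). -/

import Mathlib

noncomputable section

/-- x⁻ = (x₀,x₁,x₂). -/
def vm (x : Fin 4 → ℝ) : Fin 3 → ℝ := ![x 0, x 1, x 2]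

/-- x⁺ = (x₁,x₂,x₃). -/
def vp (x : Fin 4 → ℝ) : Fin 3 → ℝ := ![x 1, x 2, x 3]

/-- Determinant of the 3×3 matrix with rows a, b, c. -/
def det3 (a b c : Fin 3 → ℝ) : ℝ := Matrix.det (Matrix.of ![a, b, c])

/-- Determinant of the 4×4 matrix with rows a, b, c, d. -/
def det4 (a b c d : Fin 4 → ℝ) : ℝ := Matrix.det (Matrix.of ![a, b, c, d])

/-- The map C(x,y) = (det(x⁻,x⁺,y⁻), det(x⁻,x⁺,y⁺)). -/
def Cmap (x y : Fin 4 → ℝ) : Fin 2 → ℝ :=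
  ![det3 (vm x) (vp x) (vm y), det3 (vm x) (vp x) (vp y)]

/-- The trilinear map E. -/
def Emap (w x y : Fin 4 → ℝ) : Fin 2 → ℝ :=
  ![det3 (vm w) (vp x) (vm y) - det3 (vp w) (vm x) (vm y),
    det3 (vm w) (vp x) (vp y) - det3 (vp w) (vm x) (vp y)]

/-- Ψ₋(x,y,z) = C(y,z)⁻x + E(y,z,x)⁻y − C(y,x)⁻z. -/
def PsiM (x y z : Fin 4 → ℝ) : Fin 4 → ℝ :=
  Cmap y z 0 • x + Emap y z x 0 • y - Cmap y x 0 • z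

/-- Ψ₊(x,y,z) = C(y,z)⁺x + E(y,z,x)⁺y − C(y,x)⁺z. -/
def PsiP (x y z : Fin 4 → ℝ) : Fin 4 → ℝ :=
  Cmap y z 1 • x + Emap y z x 1 • y - Cmap y x 1 • z

/-- ‖x‖ = max of the absolute values of the coordinates. -/
def norm4 (x : Fin 4 → ℝ) : ℝ := max (max |x 0| |x 1|) (max |x 2| |x 3|)

/-- L(x) = max_{1≤i≤3}|x₀ξⁱ − x_i|. -/
def L4 (ξ : ℝ) (x : Fin 4 → ℝ) : ℝ :=
  max (max |x 0 * ξ - x 1| |x 0 * ξ ^ 2 - x 2|) |x 0 * ξ ^ 3 - x 3|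

/-- The unipotent substitution moving `(1, ξ, ξ², ξ³)` to `(1, 0, 0, 0)`. -/
def shiftMat (ξ : ℝ) : Matrix (Fin 4) (Fin 4) ℝ :=
  !![1, 0, 0, 0; -ξ, 1, 0, 0; ξ ^ 2, -2 * ξ, 1, 0; -ξ ^ 3, 3 * ξ ^ 2, -3 * ξ, 1]

def shift (ξ : ℝ) (x : Fin 4 → ℝ) : Fin 4 → ℝ := (shiftMat ξ).mulVec x

lemma shift_zero (ξ : ℝ) (x : Fin 4 → ℝ) : shift ξ x 0 = x 0 := by
  simp [shift, shiftMat, Matrix.mulVec, dotProduct, Fin.sum_univ_four]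

lemma shift_one (ξ : ℝ) (x : Fin 4 → ℝ) : shift ξ x 1 = x 1 - ξ * x 0 := by
  simp [shift, shiftMat, Matrix.mulVec, dotProduct, Fin.sum_univ_four]
  ring

lemma shift_two (ξ : ℝ) (x : Fin 4 → ℝ) :
    shift ξ x 2 = x 2 - 2 * ξ * x 1 + ξ ^ 2 * x 0 := by
  simp [shift, shiftMat, Matrix.mulVec, dotProduct, Fin.sum_univ_four]
  ring

lemma shift_three (ξ : ℝ) (x : Fin 4 → ℝ) :
    shift ξ x 3 = x 3 - 3 * ξ * x 2 + 3 * ξ ^ 2 * x 1 - ξ ^ 3 * x 0 := by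
  simp [shift, shiftMat, Matrix.mulVec, dotProduct, Fin.sum_univ_four]
  ring

lemma det3_eq (a b c : Fin 3 → ℝ) :
    det3 a b c = a 0 * (b 1 * c 2 - b 2 * c 1) - b 0 * (a 1 * c 2 - a 2 * c 1)
      + c 0 * (a 1 * b 2 - a 2 * b 1) := by
  simp [det3, Matrix.det_fin_three]
  ring

lemma det4_eq (a b c d : Fin 4 → ℝ) :
    det4 a b c d = a 0 * det3 (vp b) (vp c) (vp d) - b 0 * det3 (vp a) (vp c) (vp d)
      + c 0 * det3 (vp a) (vp b) (vp d) - d 0 * det3 (vp a) (vp b) (vp c) := by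
  simp [det4, det3, vp, Matrix.det_succ_column_zero, Fin.sum_univ_succ, Fin.succAbove]
  ring

lemma det4_shift (ξ : ℝ) (a b c d : Fin 4 → ℝ) :
    det4 (shift ξ a) (shift ξ b) (shift ξ c) (shift ξ d) = det4 a b c d := by
  have hdet : (shiftMat ξ).det = 1 := by
    simp [shiftMat, Matrix.det_succ_row_zero, Fin.sum_univ_succ, Fin.succAbove]
  have hrows : Matrix.of ![shift ξ a, shift ξ b, shift ξ c, shift ξ d]
      = Matrix.of ![a, b, c, d] * (shiftMat ξ).transpose := by
    ext i j
    fin_cases i <;>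
      simp [shift, Matrix.mul_apply, Matrix.mulVec, dotProduct, mul_comm]
  rw [det4, hrows, Matrix.det_mul, Matrix.det_transpose, hdet, mul_one, det4]

lemma det4_comb (v w x y z : Fin 4 → ℝ) (α β γ : ℝ) :
    det4 v w x (α • x + β • y - γ • z) = β * det4 v w x y - γ * det4 v w x z := by
  simp [det4_eq, det3_eq, vp]
  ring

lemma Cmap_shift_zero (ξ : ℝ) (x y : Fin 4 → ℝ) :
    Cmap (shift ξ x) (shift ξ y) 0 = Cmap x y 0 := by
  simp [Cmap, det3_eq, vp, vm, shift_zero, shift_one, shift_two, shift_three]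
  ring

lemma Cmap_shift_one (ξ : ℝ) (x y : Fin 4 → ℝ) :
    Cmap (shift ξ x) (shift ξ y) 1 = Cmap x y 1 - ξ * Cmap x y 0 := by
  simp [Cmap, det3_eq, vp, vm, shift_zero, shift_one, shift_two, shift_three]
  ring

lemma Emap_shift_zero (ξ : ℝ) (w x y : Fin 4 → ℝ) :
    Emap (shift ξ w) (shift ξ x) (shift ξ y) 0 = Emap w x y 0 := by
  simp [Emap, det3_eq, vp, vm, shift_zero, shift_one, shift_two, shift_three]
  ring

lemma Emap_shift_one (ξ : ℝ) (w x y : Fin 4 → ℝ) :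
    Emap (shift ξ w) (shift ξ x) (shift ξ y) 1 = Emap w x y 1 - ξ * Emap w x y 0 := by
  simp [Emap, det3_eq, vp, vm, shift_zero, shift_one, shift_two, shift_three]
  ring

lemma det4_PsiM_shift (ξ : ℝ) (v w x y z : Fin 4 → ℝ) :
    det4 (shift ξ v) (shift ξ w) (shift ξ x) (PsiM (shift ξ x) (shift ξ y) (shift ξ z))
      = det4 v w x (PsiM x y z) := by
  simp only [PsiM, det4_comb, det4_shift, Cmap_shift_zero, Emap_shift_zero]

lemma det4_PsiP_shift (ξ : ℝ) (v w x y z : Fin 4 → ℝ) :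
    det4 (shift ξ v) (shift ξ w) (shift ξ x) (PsiP (shift ξ x) (shift ξ y) (shift ξ z))
      = det4 v w x (PsiP x y z) - ξ * det4 v w x (PsiM x y z) := by
  simp only [PsiM, PsiP, det4_comb, det4_shift, Cmap_shift_one, Emap_shift_one]
  ring

/-- The first coordinate of `x` is bounded by `N`, the remaining ones by `l ≤ N`. -/
structure CoordBound (x : Fin 4 → ℝ) (N l : ℝ) : Prop where
  zero : |x 0| ≤ N
  one : |x 1| ≤ l
  two : |x 2| ≤ l
  three : |x 3| ≤ l
  le : l ≤ N

lemma CoordBound.nonneg {x : Fin 4 → ℝ} {N l : ℝ} (h : CoordBound x N l) : 0 ≤ l :=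
  (abs_nonneg _).trans h.one

lemma CoordBound.nonneg' {x : Fin 4 → ℝ} {N l : ℝ} (h : CoordBound x N l) : 0 ≤ N :=
  h.nonneg.trans h.le

lemma abs_mul_le {a b r s : ℝ} (ha : |a| ≤ r) (hb : |b| ≤ s) : |a * b| ≤ r * s := by
  rw [abs_mul]
  exact mul_le_mul ha hb (abs_nonneg _) ((abs_nonneg _).trans ha)

lemma abs_minor_le {a b c d r s : ℝ} (ha : |a| ≤ r) (hb : |b| ≤ s) (hc : |c| ≤ r)
    (hd : |d| ≤ s) : |a * b - c * d| ≤ 2 * (r * s) := by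
  have h₁ := abs_mul_le ha hb
  have h₂ := abs_mul_le hc hd
  have h₃ := abs_sub (a * b) (c * d)
  linarith

lemma abs_det3_vp_le {a b c : Fin 4 → ℝ} {A B C p q r : ℝ} (ha : CoordBound a A p)
    (hb : CoordBound b B q) (hc : CoordBound c C r) :
    |det3 (vp a) (vp b) (vp c)| ≤ 6 * (p * q * r) := by
  have h₁ := abs_mul_le ha.one (abs_minor_le hb.two hc.three hb.three hc.two)
  have h₂ := abs_mul_le hb.one (abs_minor_le ha.two hc.three ha.three hc.two)
  have h₃ := abs_mul_le hc.one (abs_minor_le ha.two hb.three ha.three hb.two)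
  rw [det3_eq]
  simp only [vp, Matrix.cons_val]
  rw [abs_le] at *
  constructor <;> linarith

/-- The part of `det4 v w x y` not involving `y 0` when the ratios decrease. -/
lemma abs_det4_add_le {v w x y : Fin 4 → ℝ} {V W X Y a b c d : ℝ} (hv : CoordBound v V a)
    (hw : CoordBound w W b) (hx : CoordBound x X c) (hy : CoordBound y Y d)
    (hvx : c * V ≤ a * X) (hwx : c * W ≤ b * X) :
    |det4 v w x y + y 0 * det3 (vp v) (vp w) (vp x)| ≤ 18 * (X * a * b * d) := by
  have h₁ := abs_mul_le hv.zero (abs_det3_vp_le hw hx hy)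
  have h₂ := abs_mul_le hw.zero (abs_det3_vp_le hv hx hy)
  have h₃ := abs_mul_le hx.zero (abs_det3_vp_le hv hw hy)
  have e₁ := mul_le_mul_of_nonneg_right hvx (mul_nonneg hw.nonneg hy.nonneg)
  have e₂ := mul_le_mul_of_nonneg_right hwx (mul_nonneg hv.nonneg hy.nonneg)
  rw [det4_eq]
  rw [abs_le] at *
  constructor <;> linarith

/-- `C(y, x)` and `E(y, z, x)` with the row coming from `x` replaced by `(t₀, t₁, t₂)`. -/
lemma coefficient_bounds {y z : Fin 4 → ℝ} {X Y Z c d e t₀ t₁ t₂ C E : ℝ}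
    (hy : CoordBound y Y d) (hz : CoordBound z Z e) (h₀ : |t₀| ≤ X) (h₁ : |t₁| ≤ c)
    (h₂ : |t₂| ≤ c) (hcX : c ≤ X) (hxy : d * X ≤ c * Y) (hyz : e * Y ≤ d * Z)
    (hC : C = det3 (vm y) (vp y) ![t₀, t₁, t₂])
    (hE : E = det3 (vm y) (vp z) ![t₀, t₁, t₂] - det3 (vp y) (vm z) ![t₀, t₁, t₂]) :
    |C| ≤ 6 * (Y * d * c) ∧ |E| ≤ 12 * (Z * d * c) ∧
      |E * y 0 - C * z 0| ≤ 8 * (Y ^ 2 * c * e + X * Z * d ^ 2) := by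
  have hc : 0 ≤ c := (abs_nonneg _).trans h₁
  have hX : 0 ≤ X := hc.trans hcX
  have hd := hy.nonneg
  have he := hz.nonneg
  have hY := hy.nonneg'
  have hZ := hz.nonneg'
  simp only [det3_eq, vp, vm, Matrix.cons_val] at hC hE
  set C' := - y 1 * (y 1 * t₂ - y 2 * t₁) + t₀ * (y 1 * y 3 - y 2 * y 2) with hC'
  set E' := y 0 * (z 2 * t₂ - z 3 * t₁) - z 1 * (y 1 * t₂ - y 2 * t₁)
    + t₀ * (y 1 * z 3 - y 2 * z 2) - y 1 * (z 1 * t₂ - z 2 * t₁)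
    - t₀ * (y 2 * z 2 - y 3 * z 1) with hE'
  set m := y 2 * t₂ - y 3 * t₁ with hm
  have hCm : C = y 0 * m + C' := by rw [hC, hC', hm]; ring
  have hEm : E = z 0 * m + E' := by rw [hE, hE', hm]; ring
  have bm : |m| ≤ 2 * (d * c) := abs_minor_le hy.two h₂ hy.three h₁
  have hdcX : d * d * c ≤ d * d * X := mul_le_mul_of_nonneg_left hcX (mul_nonneg hd hd)
  have hdY : d * (e * c) ≤ Y * (e * c) := mul_le_mul_of_nonneg_right hy.le (mul_nonneg he hc)
  have bC' : |C'| ≤ 4 * (X * d ^ 2) := by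
    have k₁ := abs_mul_le hy.one (abs_minor_le hy.one h₂ hy.two h₁)
    have k₂ := abs_mul_le h₀ (abs_minor_le hy.one hy.three hy.two hy.two)
    rw [hC']
    rw [abs_le] at *
    constructor <;> linarith
  have bE' : |E'| ≤ 6 * (Y * e * c) + 4 * (X * d * e) := by
    have k₁ := abs_mul_le hy.zero (abs_minor_le hz.two h₂ hz.three h₁)
    have k₂ := abs_mul_le hz.one (abs_minor_le hy.one h₂ hy.two h₁)
    have k₃ := abs_mul_le h₀ (abs_minor_le hy.one hz.three hy.two hz.two)
    have k₄ := abs_mul_le hy.one (abs_minor_le hz.one h₂ hz.two h₁)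
    have k₅ := abs_mul_le h₀ (abs_minor_le hy.two hz.two hy.three hz.one)
    rw [hE']
    rw [abs_le] at *
    constructor <;> linarith
  have r₁ := mul_le_mul_of_nonneg_right hxy hd
  have r₂ := mul_le_mul_of_nonneg_right hxy he
  have r₃ := mul_le_mul_of_nonneg_right hyz hc
  have r₄ := mul_le_mul_of_nonneg_right hyz (mul_nonneg hX hd)
  refine ⟨?_, ?_, ?_⟩
  · have k := abs_mul_le hy.zero bm
    rw [hCm]
    rw [abs_le] at *
    constructor <;> linarith
  · have k := abs_mul_le hz.zero bm
    rw [hEm]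
    rw [abs_le] at *
    constructor <;> linarith
  · have k₁ := abs_mul_le bE' hy.zero
    have k₂ := abs_mul_le bC' hz.zero
    have hpos : 0 ≤ Y ^ 2 * c * e := by positivity
    have hid : E * y 0 - C * z 0 = E' * y 0 - C' * z 0 := by rw [hCm, hEm]; ring
    rw [hid]
    rw [abs_le] at *
    constructor <;> linarith

lemma abs_comb_le {v w x y z : Fin 4 → ℝ} {V W X Y Z a b c d e t₀ t₁ t₂ C E : ℝ}
    (hv : CoordBound v V a) (hw : CoordBound w W b) (hx : CoordBound x X c)
    (hy : CoordBound y Y d) (hz : CoordBound z Z e)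
    (hvx : c * V ≤ a * X) (hwx : c * W ≤ b * X) (hxy : d * X ≤ c * Y) (hyz : e * Y ≤ d * Z)
    (h₀ : |t₀| ≤ X) (h₁ : |t₁| ≤ c) (h₂ : |t₂| ≤ c)
    (hC : C = det3 (vm y) (vp y) ![t₀, t₁, t₂])
    (hE : E = det3 (vm y) (vp z) ![t₀, t₁, t₂] - det3 (vp y) (vm z) ![t₀, t₁, t₂]) :
    |E * det4 v w x y - C * det4 v w x z|
      ≤ 372 * ((Y ^ 2 * c * e + X * Z * d ^ 2) * (a * b * c)) := by
  obtain ⟨bC, bE, bD⟩ := coefficient_bounds hy hz h₀ h₁ h₂ hx.le hxy hyz hC hE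
  have ha := hv.nonneg
  have hb := hw.nonneg
  have hc := hx.nonneg
  have hd := hy.nonneg
  have he := hz.nonneg
  have hX := hx.nonneg'
  have hY := hy.nonneg'
  have k₁ := abs_mul_le bD (abs_det3_vp_le hv hw hx)
  have k₂ := abs_mul_le bE (abs_det4_add_le hv hw hx hy hvx hwx)
  have k₃ := abs_mul_le bC (abs_det4_add_le hv hw hx hz hvx hwx)
  have r := mul_le_mul_of_nonneg_right hyz (show 0 ≤ X * d * (a * b * c) by positivity)
  have hpos : 0 ≤ Y ^ 2 * c * e * (a * b * c) := by positivity
  rw [abs_le] at *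
  constructor <;> linarith

lemma L4_nonneg (ξ : ℝ) (x : Fin 4 → ℝ) : 0 ≤ L4 ξ x :=
  (abs_nonneg _).trans (le_max_right _ _)

lemma norm4_pos {x : Fin 4 → ℝ} (hx : x ≠ 0) : 0 < norm4 x := by
  by_contra! h
  simp only [norm4, max_le_iff, abs_nonpos_iff] at h
  apply hx
  ext i
  fin_cases i
  exacts [h.1.1, h.1.2, h.2.1, h.2.2]

lemma coordBound_shift (ξ : ℝ) (x : Fin 4 → ℝ) :
    CoordBound (shift ξ x) ((1 + |ξ|) ^ 6 * norm4 x) ((1 + |ξ|) ^ 3 * L4 ξ x) := by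
  set t := |ξ| with ht
  have ht0 : 0 ≤ t := abs_nonneg ξ
  have hL0 : 0 ≤ L4 ξ x := L4_nonneg ξ x
  have e₁ : |x 0 * ξ - x 1| ≤ L4 ξ x := (le_max_left _ _).trans (le_max_left _ _)
  have e₂ : |x 0 * ξ ^ 2 - x 2| ≤ L4 ξ x := (le_max_right _ _).trans (le_max_left _ _)
  have e₃ : |x 0 * ξ ^ 3 - x 3| ≤ L4 ξ x := le_max_right _ _
  have n₀ : |x 0| ≤ norm4 x := (le_max_left _ _).trans (le_max_left _ _)
  have n₁ : |x 1| ≤ norm4 x := (le_max_right _ _).trans (le_max_left _ _)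
  have n₂ : |x 2| ≤ norm4 x := (le_max_left _ _).trans (le_max_right _ _)
  have n₃ : |x 3| ≤ norm4 x := (le_max_right _ _).trans (le_max_right _ _)
  have hN0 : 0 ≤ norm4 x := (abs_nonneg _).trans n₀
  have hξ : |ξ| ≤ t := le_rfl
  have hξ2 : |ξ ^ 2| ≤ t ^ 2 := (abs_pow ξ 2).le
  have hξ3 : |ξ ^ 3| ≤ t ^ 3 := (abs_pow ξ 3).le
  have l₁ : 0 ≤ t * L4 ξ x := by positivity
  have l₂ : 0 ≤ t ^ 2 * L4 ξ x := by positivity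
  have l₃ : 0 ≤ t ^ 3 * L4 ξ x := by positivity
  have m₁ : 0 ≤ t * norm4 x := by positivity
  have m₂ : 0 ≤ t ^ 2 * norm4 x := by positivity
  have m₃ : 0 ≤ t ^ 3 * norm4 x := by positivity
  have hLN : L4 ξ x ≤ (1 + t) ^ 3 * norm4 x := by
    have k₁ := abs_mul_le n₀ hξ
    have k₂ := abs_mul_le n₀ hξ2
    have k₃ := abs_mul_le n₀ hξ3
    refine max_le (max_le ?_ ?_) ?_
    · have := abs_sub (x 0 * ξ) (x 1)
      linarith
    · have := abs_sub (x 0 * ξ ^ 2) (x 2)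
      linarith
    · have := abs_sub (x 0 * ξ ^ 3) (x 3)
      linarith
  refine ⟨?_, ?_, ?_, ?_, ?_⟩
  · rw [shift_zero]
    exact n₀.trans (le_mul_of_one_le_left hN0 (one_le_pow₀ (by linarith)))
  · have hs : shift ξ x 1 = -(x 0 * ξ - x 1) := by rw [shift_one]; ring
    rw [hs, abs_neg]
    linarith
  · have hs : shift ξ x 2 = -(x 0 * ξ ^ 2 - x 2) + 2 * (ξ * (x 0 * ξ - x 1)) := by
      rw [shift_two]; ring
    have k := abs_mul_le hξ e₁
    rw [hs]
    rw [abs_le] at e₂ k ⊢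
    constructor <;> linarith
  · have hs : shift ξ x 3 = -(x 0 * ξ ^ 3 - x 3) + 3 * (ξ * (x 0 * ξ ^ 2 - x 2))
        - 3 * (ξ ^ 2 * (x 0 * ξ - x 1)) := by
      rw [shift_three]; ring
    have k₁ := abs_mul_le hξ e₂
    have k₂ := abs_mul_le hξ2 e₁
    rw [hs]
    rw [abs_le] at e₃ k₁ k₂ ⊢
    constructor <;> linarith
  · calc (1 + t) ^ 3 * L4 ξ x ≤ (1 + t) ^ 3 * ((1 + t) ^ 3 * norm4 x) := by gcongr
      _ = (1 + t) ^ 6 * norm4 x := by ring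

lemma cross_mul_le {ξ : ℝ} {x y : Fin 4 → ℝ} (hx : x ≠ 0) (hy : y ≠ 0)
    (h : L4 ξ y / norm4 y ≤ L4 ξ x / norm4 x) :
    (1 + |ξ|) ^ 3 * L4 ξ y * ((1 + |ξ|) ^ 6 * norm4 x)
      ≤ (1 + |ξ|) ^ 3 * L4 ξ x * ((1 + |ξ|) ^ 6 * norm4 y) := by
  rw [div_le_div_iff₀ (norm4_pos hy) (norm4_pos hx)] at h
  have := mul_le_mul_of_nonneg_left h (show 0 ≤ (1 + |ξ|) ^ 3 * (1 + |ξ|) ^ 6 by positivity)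
  linarith

theorem statement13 (ξ : ℝ) :
    ∃ κ : ℝ, 0 < κ ∧
      ∀ v w x y z : Fin 4 → ℝ,
        v ≠ 0 → w ≠ 0 → x ≠ 0 → y ≠ 0 → z ≠ 0 →
        L4 ξ w / norm4 w ≤ L4 ξ v / norm4 v →
        L4 ξ x / norm4 x ≤ L4 ξ w / norm4 w →
        L4 ξ y / norm4 y ≤ L4 ξ x / norm4 x →
        L4 ξ z / norm4 z ≤ L4 ξ y / norm4 y →
        ∀ ψ ∈ ({PsiM x y z, PsiP x y z} : Set (Fin 4 → ℝ)),
          |det4 v w x ψ|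
            ≤ κ * (norm4 y ^ 2 * L4 ξ x * L4 ξ z
                + norm4 x * norm4 z * L4 ξ y ^ 2) *
              (L4 ξ v * L4 ξ w * L4 ξ x) := by
  refine ⟨372 * (1 + |ξ|) ^ 28, by positivity, ?_⟩
  intro v w x y z hv hw hx hy hz hwv hxw hyx hzy ψ hψ
  have bx := coordBound_shift ξ x
  have key {t₀ t₁ t₂ C E : ℝ} :=
    abs_comb_le (t₀ := t₀) (t₁ := t₁) (t₂ := t₂) (C := C) (E := E)
      (coordBound_shift ξ v) (coordBound_shift ξ w) bx
      (coordBound_shift ξ y) (coordBound_shift ξ z) (cross_mul_le hv hx (hxw.trans hwv))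
      (cross_mul_le hw hx hxw) (cross_mul_le hx hy hyx) (cross_mul_le hy hz hzy)
  have hM := key (E := Emap (shift ξ y) (shift ξ z) (shift ξ x) 0)
    (C := Cmap (shift ξ y) (shift ξ x) 0) bx.zero bx.one bx.two rfl rfl
  have hP := key (E := Emap (shift ξ y) (shift ξ z) (shift ξ x) 1)
    (C := Cmap (shift ξ y) (shift ξ x) 1) (bx.one.trans bx.le) bx.two bx.three rfl rfl
  rw [← det4_comb _ _ _ _ _ (Cmap (shift ξ y) (shift ξ z) 0), ← PsiM, det4_PsiM_shift] at hM
  rw [← det4_comb _ _ _ _ _ (Cmap (shift ξ y) (shift ξ z) 1), ← PsiP, det4_PsiP_shift] at hP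
  set S := (norm4 y ^ 2 * L4 ξ x * L4 ξ z + norm4 x * norm4 z * L4 ξ y ^ 2)
    * (L4 ξ v * L4 ξ w * L4 ξ x) with hS
  have hS0 : 0 ≤ S := by
    have := L4_nonneg ξ v
    have := L4_nonneg ξ w
    have := L4_nonneg ξ x
    have := L4_nonneg ξ z
    have := (norm4_pos hx).le
    have := (norm4_pos hz).le
    positivity
  set B := 372 * (1 + |ξ|) ^ 27 * S with hB
  have hM' : |det4 v w x (PsiM x y z)| ≤ B := hM.trans_eq (by rw [hB, hS]; ring)
  have hP' : |det4 v w x (PsiP x y z) - ξ * det4 v w x (PsiM x y z)| ≤ B :=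
    hP.trans_eq (by rw [hB, hS]; ring)
  have hξM := abs_mul_le (le_refl |ξ|) hM'
  have hgoal : 372 * (1 + |ξ|) ^ 28
      * (norm4 y ^ 2 * L4 ξ x * L4 ξ z + norm4 x * norm4 z * L4 ξ y ^ 2)
      * (L4 ξ v * L4 ξ w * L4 ξ x) = B + |ξ| * B := by
    rw [hB, hS]; ring
  rw [hgoal]
  rcases hψ with rfl | rfl
  · exact hM'.trans (le_add_of_nonneg_right (by positivity))
  · rw [abs_le] at *
    constructor <;> linarith
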